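/- Let F be a field and let L and K be finite-dimensional nilpotent Lie algebras over F of nilpotency class at most 2. If U(L) and U(K) are isomorphic as F-algebras, then L and K are isomorphic as Lie algebras. -/

import Mathlib

section

attribute [local instance] LieRing.ofAssociativeRing

namespace UniversalEnvelopingAlgebra

theorem adjoin_range_ι (R L : Type*) [CommRing R] [LieRing L] [LieAlgebra R L] :
    Algebra.adjoin R (Set.range (ι R : L → UniversalEnvelopingAlgebra R L)) = ⊤ := by
  set S := Algebra.adjoin R (Set.range (ι R : L → UniversalEnvelopingAlgebra R L))
  let j : L →ₗ⁅R⁆ S :=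
    { toFun := fun x => ⟨ι R x, Algebra.subset_adjoin ⟨x, rfl⟩⟩
      map_add' := fun x y => Subtype.ext (map_add (ι R) x y)
      map_smul' := fun c x => Subtype.ext (map_smul (ι R) c x)
      map_lie' := fun {x y} => Subtype.ext (LieHom.map_lie (ι R) x y) }
  have hj : S.val.comp (lift R j) = AlgHom.id R _ := by
    apply hom_ext
    ext x
    exact congrArg S.val (lift_ι_apply R j x)
  refine eq_top_iff.2 fun u _ => ?_
  have hu : (lift R j u : UniversalEnvelopingAlgebra R L) = u := DFunLike.congr_fun hj u
  exact hu ▸ (lift R j u).2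

end UniversalEnvelopingAlgebra

/-- An alternating bilinear map on a free module is the antisymmetrization of a bilinear map, in
any characteristic. -/
theorem LinearMap.IsAlt.exists_eq_sub_flip {R M N ι : Type*} [CommRing R] [AddCommGroup M]
    [Module R M] [AddCommGroup N] [Module R N] [LinearOrder ι] (b : Module.Basis ι R M)
    {B : M →ₗ[R] M →ₗ[R] N} (hB : B.IsAlt) {P : Submodule R N} (hP : ∀ x y, B x y ∈ P) :
    ∃ β : M →ₗ[R] M →ₗ[R] N, B = β - β.flip ∧ ∀ x y, β x y ∈ P := by
  let β : M →ₗ[R] M →ₗ[R] N :=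
    b.constr R fun i => b.constr R fun j => if i < j then B (b i) (b j) else 0
  have hβ (i j) : β (b i) (b j) = if i < j then B (b i) (b j) else 0 := by
    simp [β, Module.Basis.constr_basis]
  refine ⟨β, ?_, fun x y => ?_⟩
  · refine LinearMap.ext_basis b b fun i j => ?_
    rw [LinearMap.sub_apply, LinearMap.sub_apply, LinearMap.flip_apply, hβ, hβ]
    rcases lt_trichotomy i j with h | rfl | h
    · simp [h, h.not_gt]
    · simp [hB (b i)]
    · simp [h, h.not_gt, hB.neg]
  · induction b.mem_span x using Submodule.span_induction with
    | zero => simp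
    | add _ _ _ _ h₁ h₂ => simpa using P.add_mem h₁ h₂
    | smul c _ _ h => simpa using P.smul_mem c h
    | mem _ hx =>
      obtain ⟨i, rfl⟩ := hx
      induction b.mem_span y using Submodule.span_induction with
      | zero => simp
      | add _ _ _ _ h₁ h₂ => simpa using P.add_mem h₁ h₂
      | smul c _ _ h => simpa using P.smul_mem c h
      | mem _ hy =>
        obtain ⟨j, rfl⟩ := hy
        rw [hβ]
        split_ifs
        · exact hP _ _
        · exact P.zero_mem

section ClassTwo

variable {F K : Type*} [Field F] [LieRing K] [LieAlgebra F K]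

theorem lie_lie_eq_zero_of_lowerCentralSeries_two
    (hK : LieModule.lowerCentralSeries F K K 2 = ⊥) (x y z : K) : ⁅x, ⁅y, z⁆⁆ = 0 := by
  have h : ⁅x, ⁅y, z⁆⁆ ∈ LieModule.lowerCentralSeries F K K 2 := by
    rw [LieModule.lowerCentralSeries_succ, LieModule.lowerCentralSeries_succ,
      LieModule.lowerCentralSeries_zero]
    exact LieSubmodule.lie_mem_lie (LieSubmodule.mem_top x)
      (LieSubmodule.lie_mem_lie (LieSubmodule.mem_top y) (LieSubmodule.mem_top z))
  rwa [hK, LieSubmodule.mem_bot] at h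

variable (F K) in
/-- The span of all brackets. -/
def bracketSpan : Submodule F K := Submodule.span F {z | ∃ x y : K, ⁅x, y⁆ = z}

theorem lie_mem_bracketSpan (x y : K) : ⁅x, y⁆ ∈ bracketSpan F K :=
  Submodule.subset_span ⟨x, y, rfl⟩

theorem lie_eq_zero_of_mem_bracketSpan (h2 : ∀ x y z : K, ⁅x, ⁅y, z⁆⁆ = 0) (x : K) {z : K}
    (hz : z ∈ bracketSpan F K) : ⁅x, z⁆ = 0 := by
  induction hz using Submodule.span_induction with
  | zero => simp
  | add _ _ _ _ h₁ h₂ => simp [h₁, h₂]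
  | smul c _ _ h => simp [h]
  | mem _ hz =>
    obtain ⟨a, b, rfl⟩ := hz
    exact h2 x a b

/-- The bracket of a Lie algebra of class at most two is the commutator of a bilinear product all
of whose triple products vanish. -/
theorem exists_bilinear_lie_eq_sub (h2 : ∀ x y z : K, ⁅x, ⁅y, z⁆⁆ = 0) :
    ∃ β : K →ₗ[F] K →ₗ[F] K, (∀ x y, ⁅x, y⁆ = β x y - β y x) ∧
      (∀ x y, β x y ∈ bracketSpan F K) ∧
      (∀ x ∈ bracketSpan F K, ∀ y, β x y = 0 ∧ β y x = 0) := by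
  obtain ⟨b⟩ : Nonempty (Module.Basis _ F K) := ⟨Module.Basis.ofVectorSpace F K⟩
  obtain ⟨_, _⟩ := exists_wellFoundedLT (Module.Basis.ofVectorSpaceIndex F K)
  obtain ⟨β, hβ, hβD⟩ := LinearMap.IsAlt.exists_eq_sub_flip b
    (B := (LieModule.toEnd F K K : K →ₗ[F] Module.End F K)) (fun x => lie_self x)
    (P := bracketSpan F K) lie_mem_bracketSpan
  have hβ' (x y : K) : ⁅x, y⁆ = β x y - β y x := LinearMap.congr_fun₂ hβ x y
  obtain ⟨p, hp⟩ := LinearMap.exists_leftInverse_of_injective (bracketSpan F K).subtype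
    (Submodule.ker_subtype _)
  let q : K →ₗ[F] K := LinearMap.id - (bracketSpan F K).subtype ∘ₗ p
  have hq (x : K) (hx : x ∈ bracketSpan F K) : q x = 0 := by
    have : p x = ⟨x, hx⟩ := LinearMap.congr_fun hp ⟨x, hx⟩
    simp [q, this]
  have hlie (x y : K) : ⁅x, q y⁆ = ⁅x, y⁆ := by
    simp [q, lie_eq_zero_of_mem_bracketSpan h2 x (p y).2]
  refine ⟨β.compl₁₂ q q, fun x y => ?_, fun x y => hβD _ _, fun x hx y => by simp [hq x hx]⟩
  rw [LinearMap.compl₁₂_apply, LinearMap.compl₁₂_apply, ← hβ', hlie, ← lie_skew x y, ← hlie y x,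
    lie_skew]

/-- A Lie algebra `K` of class at most two carries an associative product `β` with commutator the
bracket; the enveloping algebra maps onto its unitization `F × K`. -/
theorem exists_linearMap_universalEnvelopingAlgebra (h2 : ∀ x y z : K, ⁅x, ⁅y, z⁆⁆ = 0) :
    ∃ (β : K →ₗ[F] K →ₗ[F] K) (e : UniversalEnvelopingAlgebra F K →ₗ[F] F × K),
      (∀ x y, ⁅x, y⁆ = β x y - β y x) ∧ (∀ x y, β x y ∈ bracketSpan F K) ∧
      (∀ x, e (UniversalEnvelopingAlgebra.ι F x) = (0, x)) ∧ e 1 = (1, 0) ∧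
      ∀ u v, e (u * v) = ((e u).1 * (e v).1,
        (e u).1 • (e v).2 + (e v).1 • (e u).2 + β (e u).2 (e v).2) := by
  obtain ⟨β, hβ, hβD, hβ0⟩ := exists_bilinear_lie_eq_sub (F := F) h2
  have hl (x y z : K) : β (β x y) z = 0 := (hβ0 _ (hβD x y) z).1
  have hr (x y z : K) : β x (β y z) = 0 := (hβ0 _ (hβD y z) x).2
  let r : K →ₗ[F] Module.End F (F × K) :=
    { toFun := fun x => (LinearMap.inr F F K).comp
        ((LinearMap.toSpanSingleton F K x).coprod (β x))
      map_add' := fun x y => by ext <;> simp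
      map_smul' := fun c x => by ext <;> simp }
  have hr' (x : K) (p : F × K) : r x p = (0, p.1 • x + β x p.2) := by simp [r]
  let ρ : K →ₗ⁅F⁆ Module.End F (F × K) :=
    { r with
      map_lie' := fun {x y} => by
        change r ⁅x, y⁆ = ⁅r x, r y⁆
        refine LinearMap.ext fun p => ?_
        rw [LieRing.of_associative_ring_bracket, LinearMap.sub_apply, Module.End.mul_apply,
          Module.End.mul_apply]
        simp [hr', hβ x y, hl, hr] }
  let Φ := UniversalEnvelopingAlgebra.lift F ρ
  have hΦ (x : K) : Φ (UniversalEnvelopingAlgebra.ι F x) = r x :=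
    UniversalEnvelopingAlgebra.lift_ι_apply F ρ x
  let e : UniversalEnvelopingAlgebra F K →ₗ[F] F × K :=
    (LinearMap.applyₗ ((1 : F), (0 : K))).comp Φ.toLinearMap
  have he (u) : e u = Φ u (1, 0) := rfl
  have hreg (u) : ∀ p : F × K,
      Φ u p = ((e u).1 * p.1, (e u).1 • p.2 + p.1 • (e u).2 + β (e u).2 p.2) := by
    have hu : u ∈ Algebra.adjoin F (Set.range (UniversalEnvelopingAlgebra.ι F)) := by
      rw [UniversalEnvelopingAlgebra.adjoin_range_ι]; trivial
    induction hu using Algebra.adjoin_induction with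
    | mem u hu =>
      obtain ⟨x, rfl⟩ := hu
      intro p
      rw [he, hΦ, hr', hr']
      simp
    | algebraMap c => intro p; ext <;> simp [he]
    | add u v _ _ hu hv =>
      intro p
      rw [map_add, map_add, LinearMap.add_apply, hu, hv]
      ext
      · simp [add_mul]
      · simp
        module
    | mul u v _ _ hu hv =>
      intro p
      rw [he, map_mul, Module.End.mul_apply, Module.End.mul_apply, hv, hu, hv, hu]
      ext <;> simp [hl, hr, mul_assoc]
      module
  refine ⟨β, e, hβ, hβD, fun x => by rw [he, hΦ, hr']; simp, by simp [he], fun u v => ?_⟩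
  rw [he (u * v), map_mul, Module.End.mul_apply, ← he v, hreg]

variable {L : Type*} [LieRing L] [LieAlgebra F L]

/-- A surjection of enveloping algebras onto that of a Lie algebra of class at most two induces a
surjection of Lie algebras. -/
theorem exists_surjective_lieHom (h2 : ∀ x y z : K, ⁅x, ⁅y, z⁆⁆ = 0)
    (φ : UniversalEnvelopingAlgebra F L →ₐ[F] UniversalEnvelopingAlgebra F K)
    (hφ : Function.Surjective φ) : ∃ f : L →ₗ⁅F⁆ K, Function.Surjective f := by
  obtain ⟨β, e, hβ, hβD, heι, he1, hmul⟩ := exists_linearMap_universalEnvelopingAlgebra (F := F) h2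
  let f : L →ₗ⁅F⁆ K :=
    { (LinearMap.snd F F K) ∘ₗ e ∘ₗ φ.toLinearMap ∘ₗ
        (UniversalEnvelopingAlgebra.ι F (L := L)).toLinearMap with
      map_lie' := fun {x y} => by
        change (e (φ (UniversalEnvelopingAlgebra.ι F ⁅x, y⁆))).2 =
          ⁅(e (φ (UniversalEnvelopingAlgebra.ι F x))).2,
            (e (φ (UniversalEnvelopingAlgebra.ι F y))).2⁆
        rw [LieHom.map_lie, LieRing.of_associative_ring_bracket, map_sub, map_mul, map_mul,
          map_sub, hmul, hmul, hβ, Prod.snd_sub]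
        module }
  have hf (x : L) : f x = (e (φ (UniversalEnvelopingAlgebra.ι F x))).2 := rfl
  set W : Submodule F K := LinearMap.range (f : L →ₗ[F] K) ⊔ bracketSpan F K
  have hW (u) : (e (φ u)).2 ∈ W := by
    have hu : u ∈ Algebra.adjoin F (Set.range (UniversalEnvelopingAlgebra.ι F)) := by
      rw [UniversalEnvelopingAlgebra.adjoin_range_ι]; trivial
    induction hu using Algebra.adjoin_induction with
    | mem u hu =>
      obtain ⟨x, rfl⟩ := hu
      exact Submodule.mem_sup_left ⟨x, rfl⟩
    | algebraMap c =>
      rw [Algebra.algebraMap_eq_smul_one, map_smul, map_one, map_smul, he1]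
      simp
    | add u v _ _ hu hv => simpa using W.add_mem hu hv
    | mul u v _ _ hu hv =>
      rw [map_mul, hmul]
      exact W.add_mem (W.add_mem (W.smul_mem _ hv) (W.smul_mem _ hu))
        (Submodule.mem_sup_right (hβD _ _))
  have hdecomp (k : K) : ∃ x, ∃ d ∈ bracketSpan F K, f x + d = k := by
    obtain ⟨u, hu⟩ := hφ (UniversalEnvelopingAlgebra.ι F k)
    have hk : k ∈ W := by
      have := hW u
      rwa [hu, heι] at this
    obtain ⟨_, ⟨x, rfl⟩, d, hd, h⟩ := Submodule.mem_sup.1 hk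
    exact ⟨x, d, hd, h⟩
  have hbracket : bracketSpan F K ≤ LinearMap.range (f : L →ₗ[F] K) := by
    refine Submodule.span_le.2 ?_
    rintro _ ⟨a, b, rfl⟩
    obtain ⟨x, d, hd, rfl⟩ := hdecomp a
    obtain ⟨y, d', hd', rfl⟩ := hdecomp b
    refine ⟨⁅x, y⁆, ?_⟩
    have hd'' (z : K) : ⁅d, z⁆ = 0 := by
      rw [← lie_skew, lie_eq_zero_of_mem_bracketSpan h2 z hd, neg_zero]
    simp [hd'', lie_eq_zero_of_mem_bracketSpan h2 _ hd']
  refine ⟨f, fun k => ?_⟩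
  obtain ⟨x, d, hd, rfl⟩ := hdecomp k
  obtain ⟨y, rfl⟩ := hbracket hd
  exact ⟨x + y, map_add f x y⟩

end ClassTwo

end

/-- If `L` and `K` are finite-dimensional nilpotent Lie algebras of nilpotency class at most 2
(i.e. `[[L,L],L] = 0`) with isomorphic universal enveloping algebras, then `L ≅ K`. -/
theorem isomorphism_problem_class_le_two (F : Type*) [Field F]
    (L : Type*) [LieRing L] [LieAlgebra F L]
    (K : Type*) [LieRing K] [LieAlgebra F K]
    [Module.Finite F L] [Module.Finite F K]
    (hL : LieModule.lowerCentralSeries F L L 2 = ⊥)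
    (hK : LieModule.lowerCentralSeries F K K 2 = ⊥)
    (h : Nonempty (UniversalEnvelopingAlgebra F L ≃ₐ[F] UniversalEnvelopingAlgebra F K)) :
    Nonempty (L ≃ₗ⁅F⁆ K) := by
  obtain ⟨φ⟩ := h
  obtain ⟨f, hf⟩ := exists_surjective_lieHom (lie_lie_eq_zero_of_lowerCentralSeries_two hK)
    φ.toAlgHom φ.surjective
  obtain ⟨g, hg⟩ := exists_surjective_lieHom (lie_lie_eq_zero_of_lowerCentralSeries_two hL)
    φ.symm.toAlgHom φ.symm.surjective
  have hdim : Module.finrank F L = Module.finrank F K :=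
    le_antisymm (LinearMap.finrank_le_finrank_of_surjective (f := (g : K →ₗ[F] L)) hg)
      (LinearMap.finrank_le_finrank_of_surjective (f := (f : L →ₗ[F] K)) hf)
  have hinj : Function.Injective (f : L →ₗ[F] K) :=
    (LinearMap.injective_iff_surjective_of_finrank_eq_finrank hdim).2 hf
  exact ⟨LieEquiv.ofBijective f ⟨hinj, hf⟩⟩
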